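/- Let (X,d_X) and (Y,d_Y) be metric spaces, each with at least two points, let k > 0, and let T : LPM_k(X,d_X) → LPM_k(Y,d_Y) be a bijective sup-metric isometry. Then T maps the zero pseudometric on X to the zero pseudometric on Y, and T is norm-preserving: ‖T(d)‖ = ‖d‖ for every d ∈ LPM_k(X,d_X) and ‖T⁻¹(ρ)‖ = ‖ρ‖ for every ρ ∈ LPM_k(Y,d_Y). -/

import Mathlib

open Set Filter

namespace BanachStone

/-- `d` is a pseudometric. -/
def IsPseudometric {Z : Type*} (d : Z → Z → ℝ) : Prop :=
  (∀ z, d z z = 0) ∧ (∀ z w, d z w = d w z) ∧ (∀ z w v, d z v ≤ d z w + d w v)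

/-- `d` is bounded. -/
def IsBoundedPM {Z : Type*} (d : Z → Z → ℝ) : Prop := ∃ C : ℝ, ∀ z w, d z w ≤ C

/-- The sup-norm of `d`. -/
noncomputable def supNorm {Z : Type*} (d : Z → Z → ℝ) : ℝ := ⨆ p : Z × Z, d p.1 p.2

/-- The sup-metric between `d` and `ρ`. -/
noncomputable def supDist {Z : Type*} (d ρ : Z → Z → ℝ) : ℝ :=
  ⨆ p : Z × Z, |d p.1 p.2 - ρ p.1 p.2|

/-- `PM Z`: bounded continuous pseudometrics on `Z`. -/
def PM (Z : Type*) [TopologicalSpace Z] : Set (Z → Z → ℝ) :=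
  {d | IsPseudometric d ∧ IsBoundedPM d ∧ Continuous fun p : Z × Z => d p.1 p.2}

/-- The topology induced by `d` (generated by open `d`-balls). -/
def metricTopology {Z : Type*} (d : Z → Z → ℝ) : TopologicalSpace Z :=
  TopologicalSpace.generateFrom {s | ∃ z : Z, ∃ r : ℝ, s = {w | d z w < r}}

/-- `AM Z`: admissible metrics, i.e. bounded metrics inducing the topology of `Z`. -/
def AM (Z : Type*) [t : TopologicalSpace Z] : Set (Z → Z → ℝ) :=
  {d | IsPseudometric d ∧ IsBoundedPM d ∧ (∀ z w : Z, z ≠ w → 0 < d z w) ∧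
    metricTopology d = t}

/-- `Pp Z`: elements of `PM Z` attaining the sup-norm at exactly one unordered pair
of distinct points. -/
def Pp (Z : Type*) [TopologicalSpace Z] : Set (Z → Z → ℝ) :=
  {d | d ∈ PM Z ∧ ∃ z w : Z, z ≠ w ∧ d z w = supNorm d ∧
    ∀ z' w' : Z, z' ≠ w' → d z' w' = supNorm d → ({z', w'} : Set Z) = {z, w}}

/-- `UPM Z`: bounded pseudometrics uniformly continuous w.r.t. the uniformity of `Z`. -/
def UPM (Z : Type*) [UniformSpace Z] : Set (Z → Z → ℝ) :=
  {d | IsPseudometric d ∧ IsBoundedPM d ∧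
    ∀ ε : ℝ, 0 < ε → ∃ U ∈ uniformity Z, ∀ x y : Z, (x, y) ∈ U → d x y < ε}

/-- `UC Z`: bounded uniformly continuous real-valued functions on `Z`. -/
def UC (Z : Type*) [UniformSpace Z] : Set (Z → ℝ) :=
  {f | (∃ C : ℝ, ∀ z, |f z| ≤ C) ∧ UniformContinuous f}

/-- The space `U(Z)`. -/
def Ucal (Z : Type*) [UniformSpace Z] : Set (Z → Z → ℝ) :=
  {d | d ∈ PM Z ∧ ∀ ε : ℝ, 0 < ε → ∃ F : Finset (Z → ℝ), F.Nonempty ∧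
    (↑F : Set (Z → ℝ)) ⊆ UC Z ∧ ∃ δ : ℝ, 0 < δ ∧
    ∀ x y : Z, (∀ f ∈ F, |f x - f y| < δ) → d x y < ε}

/-- The uniformity filter of the coarsest uniformity on `Z` making every bounded
uniformly continuous real-valued function on `Z` uniformly continuous. -/
noncomputable def U0 (Z : Type*) [UniformSpace Z] : Filter (Z × Z) :=
  ⨅ f ∈ UC Z, Filter.comap (fun p : Z × Z => (f p.1, f p.2)) (uniformity ℝ)

/-- The Lipschitz constant of a pseudometric on a metric space. -/
noncomputable def lip {Z : Type*} [PseudoMetricSpace Z] (d : Z → Z → ℝ) : ENNReal :=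
  ⨆ (x : Z) (y : Z) (_ : x ≠ y), ENNReal.ofReal (d x y / dist x y)

/-- `LPM Z`: bounded Lipschitz continuous pseudometrics on `Z`. -/
def LPM (Z : Type*) [MetricSpace Z] : Set (Z → Z → ℝ) :=
  {d | IsPseudometric d ∧ IsBoundedPM d ∧ lip d < ⊤}

/-- `LPM_k Z`: elements of `LPM Z` with Lipschitz constant `< k`. -/
def LPMlt (k : ℝ) (Z : Type*) [MetricSpace Z] : Set (Z → Z → ℝ) :=
  {d | d ∈ LPM Z ∧ lip d < ENNReal.ofReal k}

/-- `\overline{LPM}_k Z`: elements of `LPM Z` with Lipschitz constant `≤ k`. -/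
def LPMle (k : ℝ) (Z : Type*) [MetricSpace Z] : Set (Z → Z → ℝ) :=
  {d | d ∈ LPM Z ∧ lip d ≤ ENNReal.ofReal k}

/-- `Z` has exactly two points. -/
def ExactlyTwo (Z : Type*) : Prop := ∃ a b : Z, a ≠ b ∧ ∀ c : Z, c = a ∨ c = b

/-- The two-element subsets of `Z`. -/
def Dset (Z : Type*) : Set (Set Z) := {s | ∃ a b : Z, a ≠ b ∧ s = {a, b}}

section Pseudometric

variable {Z : Type*}

theorem IsPseudometric.nonneg {d : Z → Z → ℝ} (hd : IsPseudometric d) (z w : Z) :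
    0 ≤ d z w := by
  have h := hd.2.2 z w z
  rw [hd.1, hd.2.1 w z] at h
  linarith

theorem IsPseudometric.const_mul {d : Z → Z → ℝ} (hd : IsPseudometric d) {c : ℝ} (hc : 0 ≤ c) :
    IsPseudometric fun z w => c * d z w := by
  refine ⟨fun z => by simp [hd.1], fun z w => by simp only [hd.2.1 z w], fun z w v => ?_⟩
  rw [← mul_add]
  exact mul_le_mul_of_nonneg_left (hd.2.2 z w v) hc

theorem IsBoundedPM.le_supNorm {d : Z → Z → ℝ} (hd : IsBoundedPM d) (z w : Z) :
    d z w ≤ supNorm d := by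
  obtain ⟨C, hC⟩ := hd
  exact le_ciSup (f := fun p : Z × Z => d p.1 p.2) ⟨C, by rintro _ ⟨p, rfl⟩; exact hC _ _⟩ (z, w)

theorem IsPseudometric.supDist_zero_left {d : Z → Z → ℝ} (hd : IsPseudometric d) :
    supDist (fun _ _ => 0) d = supNorm d := by
  simp [supDist, supNorm, abs_of_nonneg (hd.nonneg _ _)]

theorem supDist_le_max_supNorm [Nonempty Z] {d e : Z → Z → ℝ}
    (hd : IsPseudometric d) (hd' : IsBoundedPM d) (he : IsPseudometric e) (he' : IsBoundedPM e) :
    supDist d e ≤ max (supNorm d) (supNorm e) := by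
  refine ciSup_le fun p => ?_
  have h₁ := hd.nonneg p.1 p.2
  have h₂ := he.nonneg p.1 p.2
  rw [abs_le]
  constructor
  · linarith [le_max_right (supNorm d) (supNorm e), he'.le_supNorm p.1 p.2]
  · linarith [le_max_left (supNorm d) (supNorm e), hd'.le_supNorm p.1 p.2]

theorem IsPseudometric.supDist_const_mul {d : Z → Z → ℝ} (hd : IsPseudometric d) (a b : ℝ) :
    supDist (fun z w => a * d z w) (fun z w => b * d z w) = |a - b| * supNorm d := by
  simp only [supDist, supNorm]
  rw [Real.mul_iSup_of_nonneg (abs_nonneg _)]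
  congr 1
  ext p
  rw [← sub_mul, abs_mul, abs_of_nonneg (hd.nonneg _ _)]

end Pseudometric

section Lipschitz

variable {Z : Type*} [MetricSpace Z]

theorem mem_LPMlt_iff {k : ℝ} (hk : 0 < k) {d : Z → Z → ℝ} :
    d ∈ LPMlt k Z ↔ IsPseudometric d ∧ IsBoundedPM d ∧
      ∃ L : ℝ, 0 ≤ L ∧ L < k ∧ ∀ x y, d x y ≤ L * dist x y := by
  constructor
  · rintro ⟨⟨hd, hb, hfin⟩, hlt⟩
    refine ⟨hd, hb, (lip d).toReal, ENNReal.toReal_nonneg, ?_, fun x y => ?_⟩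
    · rwa [← ENNReal.lt_ofReal_iff_toReal_lt hfin.ne]
    · rcases eq_or_ne x y with rfl | hxy
      · simp [hd.1]
      · rw [← div_le_iff₀ (dist_pos.2 hxy)]
        refine (ENNReal.ofReal_le_iff_le_toReal hfin.ne).1 ?_
        exact le_iSup_of_le x (le_iSup_of_le y (le_iSup_of_le hxy le_rfl))
  · rintro ⟨hd, hb, L, -, hLk, hL⟩
    have hle : lip d ≤ ENNReal.ofReal L := by
      refine iSup_le fun x => iSup_le fun y => iSup_le fun hxy => ENNReal.ofReal_le_ofReal ?_
      exact (div_le_iff₀ (dist_pos.2 hxy)).2 (hL x y)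
    exact ⟨⟨hd, hb, hle.trans_lt ENNReal.ofReal_lt_top⟩,
      hle.trans_lt ((ENNReal.ofReal_lt_ofReal_iff hk).2 hLk)⟩

theorem zero_mem_LPMlt {k : ℝ} (hk : 0 < k) : (fun _ _ => (0 : ℝ)) ∈ LPMlt k Z :=
  (mem_LPMlt_iff hk).2 ⟨⟨by simp, by simp, by simp⟩, ⟨0, by simp⟩, 0, le_rfl, hk, by simp⟩

theorem exists_const_mul_mem_LPMlt {k : ℝ} (hk : 0 < k) {d : Z → Z → ℝ} (hd : d ∈ LPMlt k Z) :
    ∃ ε : ℝ, 0 < ε ∧ (fun z w => (1 + ε) * d z w) ∈ LPMlt k Z ∧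
      (fun z w => (1 - ε) * d z w) ∈ LPMlt k Z := by
  obtain ⟨hpm, ⟨C, hC⟩, L, hL0, hLk, hL⟩ := (mem_LPMlt_iff hk).1 hd
  have scale : ∀ c : ℝ, 0 ≤ c → c * L < k → (fun z w => c * d z w) ∈ LPMlt k Z := by
    intro c hc hcL
    refine (mem_LPMlt_iff hk).2 ⟨hpm.const_mul hc,
      ⟨c * C, fun z w => mul_le_mul_of_nonneg_left (hC z w) hc⟩,
      c * L, mul_nonneg hc hL0, hcL, fun x y => ?_⟩
    rw [mul_assoc]
    exact mul_le_mul_of_nonneg_left (hL x y) hc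
  have hε : 0 < (k - L) / (2 * k) := div_pos (by linarith) (by linarith)
  have hεk : (k - L) / (2 * k) * k = (k - L) / 2 := by field_simp
  refine ⟨(k - L) / (2 * k), hε, scale _ (by linarith) ?_, scale _ ?_ ?_⟩
  · nlinarith
  · rw [sub_nonneg, div_le_one (by linarith)]
    linarith
  · nlinarith

/-- The zero pseudometric is the only element `p` of `LPMlt k Z` such that
`supDist d e ≤ max (supDist p d) (supDist p e)` for all `d` and `e`. -/
theorem eq_zero_of_supDist_le_max {k : ℝ} (hk : 0 < k) {p : Z → Z → ℝ} (hp : p ∈ LPMlt k Z)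
    (h : ∀ d ∈ LPMlt k Z, ∀ e ∈ LPMlt k Z, supDist d e ≤ max (supDist p d) (supDist p e)) :
    p = fun _ _ => 0 := by
  obtain ⟨ε, hε, h₁, h₂⟩ := exists_const_mul_mem_LPMlt hk hp
  have hpm := hp.1.1
  have key := h _ h₁ _ h₂
  have hdist : ∀ c : ℝ, supDist p (fun z w => c * p z w) = |1 - c| * supNorm p := fun c => by
    simpa using hpm.supDist_const_mul 1 c
  rw [hpm.supDist_const_mul, hdist, hdist, show 1 + ε - (1 - ε) = 2 * ε by ring,
    show 1 - (1 + ε) = -ε by ring, show 1 - (1 - ε) = ε by ring, abs_neg, max_self,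
    abs_of_pos hε, abs_of_pos (by linarith)] at key
  have hS : supNorm p ≤ 0 := by
    by_contra! hpos
    nlinarith [mul_pos hε hpos]
  ext z w
  exact le_antisymm ((hp.1.2.1.le_supNorm z w).trans hS) (hpm.nonneg z w)

end Lipschitz

theorem stmt10 {X Y : Type*} [MetricSpace X] [MetricSpace Y]
    [Nontrivial X] [Nontrivial Y] (k : ℝ) (hk : 0 < k)
    (T : (X → X → ℝ) → (Y → Y → ℝ))
    (hbij : Set.BijOn T (LPMlt k X) (LPMlt k Y))
    (hiso : ∀ d ∈ LPMlt k X, ∀ e ∈ LPMlt k X, supDist (T d) (T e) = supDist d e) :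
    T (fun _ _ => (0 : ℝ)) = (fun _ _ => (0 : ℝ)) ∧
    (∀ d ∈ LPMlt k X, supNorm (T d) = supNorm d) ∧
    (∀ ρ ∈ LPMlt k Y, ∀ d ∈ LPMlt k X, T d = ρ → supNorm d = supNorm ρ) := by
  have hzero := zero_mem_LPMlt (Z := X) hk
  have hT : T (fun _ _ => (0 : ℝ)) = fun _ _ => (0 : ℝ) := by
    refine eq_zero_of_supDist_le_max hk (hbij.mapsTo hzero) fun d' hd' e' he' => ?_
    obtain ⟨d, hd, rfl⟩ := hbij.surjOn hd'
    obtain ⟨e, he, rfl⟩ := hbij.surjOn he'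
    rw [hiso d hd e he, hiso _ hzero d hd, hiso _ hzero e he, hd.1.1.supDist_zero_left,
      he.1.1.supDist_zero_left]
    exact supDist_le_max_supNorm hd.1.1 hd.1.2.1 he.1.1 he.1.2.1
  have hnorm : ∀ d ∈ LPMlt k X, supNorm (T d) = supNorm d := fun d hd => by
    rw [← (hbij.mapsTo hd).1.1.supDist_zero_left, ← hd.1.1.supDist_zero_left, ← hiso _ hzero d hd,
      hT]
  refine ⟨hT, hnorm, ?_⟩
  rintro _ - d hd rfl
  exact (hnorm d hd).symm

end BanachStone
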